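/- Uniform bound for the game values (Euclidean Carnot group case, from the proof of Proposition 4.1 of the paper): assume ψ : ℝ^N → ℝ is bounded and that F satisfies F(t, p, η, 0) = 0 for all (t, p) ∈ [0, T] × ℝ^N and all η ∈ ℝ^N \ {0}, together with (F3): F(t, p, η, X) − F(t, p, η, X̂) ≤ (λ₁²/2)·E⁺(X̂ − X) for all (t, p), η ≠ 0 and X, X̂ ∈ Sym_N(ℝ), where λ₁ > 0. Then there exists ε₀ ∈ (0, 1), depending only on N and λ₁, such that for every ε ∈ (0, ε₀] and every (t, p) ∈ [0, T] × ℝ^N one has |u^ε(t, p)| ≤ sup_{q ∈ ℝ^N} |ψ(q)|. -/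

import Mathlib

open scoped RealInnerProductSpace

/-- Operator norm of an `N × N` real matrix, acting on Euclidean space. -/
noncomputable def opNorm {m : ℕ} (X : Matrix (Fin m) (Fin m) ℝ) : ℝ :=
  ‖(Matrix.toEuclideanCLM (𝕜 := ℝ) X : EuclideanSpace ℝ (Fin m) →L[ℝ] EuclideanSpace ℝ (Fin m))‖

/-- The action of a matrix on a Euclidean vector. -/
noncomputable def matVec {m : ℕ} (X : Matrix (Fin m) (Fin m) ℝ)
    (v : EuclideanSpace ℝ (Fin m)) : EuclideanSpace ℝ (Fin m) :=
  Matrix.toEuclideanCLM (𝕜 := ℝ) X v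

/-- `E⁺(X)`: the positive part of the largest eigenvalue of a symmetric matrix `X`. -/
noncomputable def Eplus {m : ℕ} (X : Matrix (Fin m) (Fin m) ℝ) : ℝ :=
  max 0 (sSup {r : ℝ | ∃ v : EuclideanSpace ℝ (Fin m), ‖v‖ = 1 ∧ r = ⟪matVec X v, v⟫})

/-- The ℓ¹-norm on `ℝ^N` (the homogeneous gauge in the Euclidean Carnot group). -/
noncomputable def l1Norm {m : ℕ} (v : EuclideanSpace ℝ (Fin m)) : ℝ := ∑ i, |v i|

/-- A modulus of continuity: a nondecreasing function `ω : [0,∞) → [0,∞)` with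
`ω(0) = 0` and `ω(r) → 0` as `r → 0⁺`. -/
def IsModulus (ω : ℝ → ℝ) : Prop :=
  (∀ r, 0 ≤ r → 0 ≤ ω r) ∧ MonotoneOn ω (Set.Ici 0) ∧ ω 0 = 0 ∧
    Filter.Tendsto ω (nhdsWithin 0 (Set.Ioi 0)) (nhds 0)

/-- The value function of the two-person deterministic game with `k` steps
remaining: `gameVal μ ε ψ F k t p` is `ψ p` when `k = 0` and otherwise is
`(1 + με²)⁻¹ inf_{η,X} sup_ν [gameVal (k-1) (t - ε²) (p + εν) + R^ε(t,p,ν,η,X)]`,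
where `η` ranges over `ℝ^N \ {0}` with `‖η‖ ≤ ε^{-1/4}`, `X` over symmetric
matrices with `‖X‖ ≤ ε^{-1/2}`, `ν` over `ℝ^N` with `‖ν‖₁ ≤ ε^{-1/4}`, and
`R^ε(t,p,ν,η,X) = -ε⟨η,ν⟩ - (ε²/2)⟨Xν,ν⟩ - ε²F(t,p,η,X)`. -/
noncomputable def gameVal {N : ℕ} (μ ε : ℝ) (ψ : EuclideanSpace ℝ (Fin N) → ℝ)
    (F : ℝ → EuclideanSpace ℝ (Fin N) → EuclideanSpace ℝ (Fin N) →
      Matrix (Fin N) (Fin N) ℝ → ℝ) :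
    ℕ → ℝ → EuclideanSpace ℝ (Fin N) → ℝ
  | 0, _t, p => ψ p
  | k + 1, t, p =>
      (1 + μ * ε ^ 2)⁻¹ *
        iInf (fun ηX : {q : EuclideanSpace ℝ (Fin N) × Matrix (Fin N) (Fin N) ℝ //
            q.1 ≠ 0 ∧ ‖q.1‖ ≤ ε ^ (-(1/4 : ℝ)) ∧ q.2.IsSymm ∧ opNorm q.2 ≤ ε ^ (-(1/2 : ℝ))} =>
          iSup (fun ν : {v : EuclideanSpace ℝ (Fin N) // l1Norm v ≤ ε ^ (-(1/4 : ℝ))} =>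
            gameVal μ ε ψ F k (t - ε ^ 2) (p + ε • ν.1) +
              (-(ε * ⟪ηX.1.1, ν.1⟫) - ε ^ 2 / 2 * ⟪matVec ηX.1.2 ν.1, ν.1⟫
                - ε ^ 2 * F t p ηX.1.1 ηX.1.2)))

/-- `k_t`: the index of the time step containing `t`, i.e. the unique positive
integer with `t ∈ ((k_t - 1)ε², k_t ε²]` for `t > 0`, and `0` for `t ≤ 0`. -/
noncomputable def kIdx (ε t : ℝ) : ℕ := ⌈t / ε ^ 2⌉₊

/-- The value `u^ε(t, p)` of the deterministic game with maturity `t`. -/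
noncomputable def uVal {N : ℕ} (μ ε : ℝ) (ψ : EuclideanSpace ℝ (Fin N) → ℝ)
    (F : ℝ → EuclideanSpace ℝ (Fin N) → EuclideanSpace ℝ (Fin N) →
      Matrix (Fin N) (Fin N) ℝ → ℝ) (t : ℝ) (p : EuclideanSpace ℝ (Fin N)) : ℝ :=
  gameVal μ ε ψ F (kIdx ε t) t p

theorem norm_le_l1Norm {m : ℕ} (v : EuclideanSpace ℝ (Fin m)) : ‖v‖ ≤ l1Norm v := by
  rw [EuclideanSpace.norm_eq]
  refine Real.sqrt_le_iff.2 ⟨Finset.sum_nonneg fun i _ => abs_nonneg _, ?_⟩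
  simp only [Real.norm_eq_abs, l1Norm]
  exact Finset.sum_sq_le_sq_sum_of_nonneg fun i _ => abs_nonneg _

theorem l1Norm_le_card_mul_norm {m : ℕ} (v : EuclideanSpace ℝ (Fin m)) :
    l1Norm v ≤ m * ‖v‖ := by
  have h : ∀ i ∈ (Finset.univ : Finset (Fin m)), |v i| ≤ ‖v‖ := fun i _ => PiLp.norm_apply_le v i
  simpa [l1Norm] using Finset.sum_le_card_nsmul _ _ _ h

theorem l1Norm_smul {m : ℕ} (c : ℝ) (v : EuclideanSpace ℝ (Fin m)) :
    l1Norm (c • v) = |c| * l1Norm v := by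
  simp [l1Norm, abs_mul, Finset.mul_sum]

theorem norm_matVec_le {m : ℕ} (X : Matrix (Fin m) (Fin m) ℝ) (v : EuclideanSpace ℝ (Fin m)) :
    ‖matVec X v‖ ≤ opNorm X * ‖v‖ :=
  ContinuousLinearMap.le_opNorm _ v

theorem matVec_smul {m : ℕ} (X : Matrix (Fin m) (Fin m) ℝ) (c : ℝ)
    (v : EuclideanSpace ℝ (Fin m)) : matVec X (c • v) = c • matVec X v :=
  map_smul _ c v

/-- The Rayleigh quotient attains `E⁺` at a unit vector whenever `E⁺` is positive. -/
theorem exists_norm_eq_one_of_Eplus_pos {m : ℕ} (hm : 1 ≤ m) (X : Matrix (Fin m) (Fin m) ℝ)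
    (hX : 0 < Eplus X) :
    ∃ v : EuclideanSpace ℝ (Fin m), ‖v‖ = 1 ∧ ⟪matVec X v, v⟫ = Eplus X := by
  have hc : Continuous fun v : EuclideanSpace ℝ (Fin m) => ⟪matVec X v, v⟫ := by
    unfold matVec
    fun_prop
  have : Nonempty (Fin m) := ⟨⟨0, hm⟩⟩
  obtain ⟨v, hv, hmax⟩ := (isCompact_sphere (0 : EuclideanSpace ℝ (Fin m)) 1).exists_isMaxOn
    (NormedSpace.sphere_nonempty.2 zero_le_one) hc.continuousOn
  have hv1 : ‖v‖ = 1 := by simpa using hv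
  have hgr : IsGreatest {r : ℝ | ∃ v : EuclideanSpace ℝ (Fin m), ‖v‖ = 1 ∧ r = ⟪matVec X v, v⟫}
      ⟪matVec X v, v⟫ := by
    refine ⟨⟨v, hv1, rfl⟩, ?_⟩
    rintro _ ⟨w, hw, rfl⟩
    exact hmax (show w ∈ Metric.sphere 0 1 by simpa using hw)
  refine ⟨v, hv1, ?_⟩
  unfold Eplus at hX ⊢
  rw [hgr.csSup_eq] at hX ⊢
  exact (max_eq_right ((lt_max_iff.1 hX).resolve_left (lt_irrefl 0)).le).symm

/-- Against any choice of `(η, X)` the maximizing player has a move with nonnegative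
running cost. -/
theorem exists_runningCost_nonneg {m : ℕ} (hm : 1 ≤ m) {lam ε f B : ℝ} (hlam : 0 ≤ lam)
    (hε : 0 ≤ ε) (hB : lam * m ≤ B) (η : EuclideanSpace ℝ (Fin m))
    (X : Matrix (Fin m) (Fin m) ℝ) (hf : f ≤ lam ^ 2 / 2 * Eplus (-X)) :
    ∃ ν : EuclideanSpace ℝ (Fin m), l1Norm ν ≤ B ∧
      0 ≤ -(ε * ⟪η, ν⟫) - ε ^ 2 / 2 * ⟪matVec X ν, ν⟫ - ε ^ 2 * f := by
  rcases (show 0 ≤ Eplus (-X) from le_max_left 0 _).eq_or_lt with h0 | h0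
  · refine ⟨0, ?_, ?_⟩
    · simp only [l1Norm, PiLp.zero_apply, abs_zero, Finset.sum_const_zero]
      exact (by positivity : 0 ≤ lam * m).trans hB
    · rw [← h0, mul_zero] at hf
      simp only [inner_zero_right, mul_zero]
      nlinarith [sq_nonneg ε]
  · obtain ⟨v, hv, hvX⟩ := exists_norm_eq_one_of_Eplus_pos hm (-X) h0
    obtain ⟨s, hs, hsη⟩ : ∃ s : ℝ, |s| = lam ∧ s * ⟪η, v⟫ ≤ 0 := by
      rcases le_total 0 ⟪η, v⟫ with h | h
      · exact ⟨-lam, by simp [abs_of_nonneg hlam], by nlinarith⟩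
      · exact ⟨lam, abs_of_nonneg hlam, by nlinarith⟩
    have hq : ⟪matVec X (s • v), s • v⟫ = -(lam ^ 2 * Eplus (-X)) := by
      have hneg : matVec (-X) v = -matVec X v := by simp [matVec]
      rw [← hvX, hneg, matVec_smul, real_inner_smul_left, real_inner_smul_right, inner_neg_left,
        ← hs, sq_abs]
      ring
    refine ⟨s • v, ?_, ?_⟩
    · rw [l1Norm_smul, hs]
      have := l1Norm_le_card_mul_norm v
      rw [hv, mul_one] at this
      exact (mul_le_mul_of_nonneg_left this hlam).trans hB
    · rw [hq, real_inner_smul_right]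
      nlinarith [mul_nonneg (sq_nonneg ε) (sub_nonneg.2 hf), mul_nonneg hε (neg_nonneg.2 hsη)]

theorem exists_ne_zero_norm_le {m : ℕ} (hm : 1 ≤ m) {δ : ℝ} (hδ : 0 < δ) :
    ∃ η : EuclideanSpace ℝ (Fin m), η ≠ 0 ∧ ‖η‖ ≤ δ := by
  have : Nonempty (Fin m) := ⟨⟨0, hm⟩⟩
  obtain ⟨η, hη⟩ := exists_norm_eq (EuclideanSpace ℝ (Fin m)) hδ.le
  exact ⟨η, norm_pos_iff.1 (hη ▸ hδ), hη.le⟩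

/-- One step of the game does not increase the uniform bound of the value function. -/
theorem abs_gameVal_succ_le {N : ℕ} (hN : 1 ≤ N) {lam μ ε M t : ℝ} (hlam : 0 ≤ lam) (hμ : 0 ≤ μ)
    (hε : 0 < ε) (hB : lam * N ≤ ε ^ (-(1/4 : ℝ))) (ψ : EuclideanSpace ℝ (Fin N) → ℝ)
    (F : ℝ → EuclideanSpace ℝ (Fin N) → EuclideanSpace ℝ (Fin N) → Matrix (Fin N) (Fin N) ℝ → ℝ)
    (p : EuclideanSpace ℝ (Fin N)) (k : ℕ) (hF0 : ∀ η, η ≠ 0 → F t p η 0 = 0)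
    (hF : ∀ η, η ≠ 0 → ∀ X : Matrix (Fin N) (Fin N) ℝ, X.IsSymm →
      F t p η X ≤ lam ^ 2 / 2 * Eplus (-X))
    (hk : ∀ q, |gameVal μ ε ψ F k (t - ε ^ 2) q| ≤ M) :
    |gameVal μ ε ψ F (k + 1) t p| ≤ M := by
  have hM : 0 ≤ M := (abs_nonneg _).trans (hk 0)
  have hB0 : 0 < ε ^ (-(1/4 : ℝ)) := Real.rpow_pos_of_pos hε _
  have hC0 : 0 < ε ^ (-(1/2 : ℝ)) := Real.rpow_pos_of_pos hε _
  unfold gameVal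
  set B : ℝ := ε ^ (-(1/4 : ℝ))
  set C : ℝ := ε ^ (-(1/2 : ℝ))
  set S := {q : EuclideanSpace ℝ (Fin N) × Matrix (Fin N) (Fin N) ℝ //
    q.1 ≠ 0 ∧ ‖q.1‖ ≤ B ∧ q.2.IsSymm ∧ opNorm q.2 ≤ C}
  set V := {v : EuclideanSpace ℝ (Fin N) // l1Norm v ≤ B}
  set G : S → V → ℝ := fun ηX ν => gameVal μ ε ψ F k (t - ε ^ 2) (p + ε • ν.1) +
    (-(ε * ⟪ηX.1.1, ν.1⟫) - ε ^ 2 / 2 * ⟪matVec ηX.1.2 ν.1, ν.1⟫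
      - ε ^ 2 * F t p ηX.1.1 ηX.1.2) with hG
  change |(1 + μ * ε ^ 2)⁻¹ * ⨅ ηX, ⨆ ν, G ηX ν| ≤ M
  have hνB (ν : V) : ‖ν.1‖ ≤ B := (norm_le_l1Norm _).trans ν.2
  have hη0 (η : EuclideanSpace ℝ (Fin N)) (ν : V) : -⟪η, ν.1⟫ ≤ ‖η‖ * B :=
    (neg_le_abs _).trans ((abs_real_inner_le_norm _ _).trans
      (mul_le_mul_of_nonneg_left (hνB ν) (norm_nonneg _)))
  have hbdd (ηX : S) : BddAbove (Set.range (G ηX)) := by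
    refine ⟨M + (ε * (‖ηX.1.1‖ * B) + ε ^ 2 / 2 * (C * B * B) - ε ^ 2 * F t p ηX.1.1 ηX.1.2), ?_⟩
    rintro _ ⟨ν, rfl⟩
    have h1 : -⟪matVec ηX.1.2 ν.1, ν.1⟫ ≤ C * B * B := by
      refine (neg_le_abs _).trans ((abs_real_inner_le_norm _ _).trans ?_)
      have := (norm_matVec_le ηX.1.2 ν.1).trans
        (mul_le_mul ηX.2.2.2.2 (hνB ν) (norm_nonneg _) hC0.le)
      exact mul_le_mul this (hνB ν) (norm_nonneg _) (by positivity)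
    have h2 := mul_le_mul_of_nonneg_left (hη0 ηX.1.1 ν) hε.le
    have h3 := mul_le_mul_of_nonneg_left h1 (by positivity : 0 ≤ ε ^ 2 / 2)
    have h4 := (abs_le.1 (hk (p + ε • ν.1))).2
    simp only [hG]
    linarith
  have hlow (ηX : S) : -M ≤ ⨆ ν, G ηX ν := by
    obtain ⟨ν, hν, hR⟩ := exists_runningCost_nonneg hN hlam hε.le hB ηX.1.1 ηX.1.2
      (hF _ ηX.2.1 _ ηX.2.2.2.1)
    refine le_trans ?_ (le_ciSup (hbdd ηX) ⟨ν, hν⟩)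
    have := (abs_le.1 (hk (p + ε • ν))).1
    simp only [hG]
    linarith
  have : Nonempty V := ⟨⟨0, by simpa [l1Norm] using hB0.le⟩⟩
  have hsmall {δ : ℝ} (hδ : 0 < δ) : ∃ ηX : S, ⨆ ν, G ηX ν ≤ M + δ := by
    obtain ⟨η, hη, hηδ⟩ := exists_ne_zero_norm_le hN (lt_min hB0 (div_pos hδ (mul_pos hε hB0)))
    refine ⟨⟨(η, 0), hη, hηδ.trans (min_le_left _ _), Matrix.isSymm_zero, by
      simpa [opNorm] using hC0.le⟩, ciSup_le fun ν => ?_⟩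
    have h1 := mul_le_mul_of_nonneg_left (hη0 η ν) hε.le
    have h2 := (le_div_iff₀ (mul_pos hε hB0)).1 (hηδ.trans (min_le_right _ _))
    have h3 := (abs_le.1 (hk (p + ε • ν.1))).2
    have h4 : matVec (0 : Matrix (Fin N) (Fin N) ℝ) ν.1 = 0 := by simp [matVec]
    simp only [hG, h4, hF0 η hη, inner_zero_left, mul_zero]
    linarith
  have : Nonempty S := ⟨(hsmall one_pos).choose⟩
  have habs : |⨅ ηX, ⨆ ν, G ηX ν| ≤ M := by
    refine abs_le.2 ⟨le_ciInf hlow, le_of_forall_pos_le_add fun δ hδ => ?_⟩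
    obtain ⟨ηX, h⟩ := hsmall hδ
    exact (ciInf_le ⟨-M, by rintro _ ⟨x, rfl⟩; exact hlow x⟩ ηX).trans h
  have hden : 1 ≤ 1 + μ * ε ^ 2 := le_add_of_nonneg_right (by positivity)
  rw [abs_mul, abs_of_nonneg (inv_nonneg.2 (zero_le_one.trans hden))]
  exact (mul_le_of_le_one_left (abs_nonneg _) (inv_le_one_of_one_le₀ hden)).trans habs

/-- Uniform bound for the game values (Euclidean Carnot group case): if `ψ` is
bounded, `F(t, p, η, 0) = 0` on `[0,T]` and (F3) holds with constant `λ₁`, then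
there is `ε₀ ∈ (0,1)`, depending only on `N` and `λ₁`, with
`|u^ε(t, p)| ≤ sup_q |ψ(q)|` for all `ε ∈ (0, ε₀]` and `(t,p) ∈ [0,T] × ℝ^N`. -/
theorem game_value_uniform_bound {N : ℕ} (hN : 1 ≤ N) (lam1 : ℝ) (hlam1 : 0 < lam1) :
    ∃ ε0 : ℝ, 0 < ε0 ∧ ε0 < 1 ∧
      ∀ T μ : ℝ, 0 < T → 0 ≤ μ →
        ∀ (ψ : EuclideanSpace ℝ (Fin N) → ℝ)
          (F : ℝ → EuclideanSpace ℝ (Fin N) → EuclideanSpace ℝ (Fin N) →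
            Matrix (Fin N) (Fin N) ℝ → ℝ),
          (∃ M : ℝ, ∀ q : EuclideanSpace ℝ (Fin N), |ψ q| ≤ M) →
          (∀ (t : ℝ) (p η : EuclideanSpace ℝ (Fin N)), 0 ≤ t → t ≤ T → η ≠ 0 →
            F t p η 0 = 0) →
          (∀ (t : ℝ) (p η : EuclideanSpace ℝ (Fin N)), 0 ≤ t → t ≤ T → η ≠ 0 →
            ∀ X Xh : Matrix (Fin N) (Fin N) ℝ, X.IsSymm → Xh.IsSymm →
              F t p η X - F t p η Xh ≤ lam1 ^ 2 / 2 * Eplus (Xh - X)) →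
          ∀ ε : ℝ, 0 < ε → ε ≤ ε0 →
            ∀ (t : ℝ) (p : EuclideanSpace ℝ (Fin N)), 0 ≤ t → t ≤ T →
              |uVal μ ε ψ F t p| ≤ ⨆ q : EuclideanSpace ℝ (Fin N), |ψ q| := by
  have hNpos : (0 : ℝ) < N := by exact_mod_cast hN
  have hc : 0 < lam1 * N := mul_pos hlam1 hNpos
  refine ⟨min (1 / 2) ((lam1 * N) ^ (-4 : ℝ)), lt_min (by norm_num) (Real.rpow_pos_of_pos hc _),
    (min_le_left _ _).trans_lt (by norm_num), ?_⟩
  intro T μ _ hμ ψ F ⟨M, hM⟩ hF0 hF3 ε hε hε0 t p ht hT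
  have hB : lam1 * N ≤ ε ^ (-(1/4 : ℝ)) := by
    have h := Real.rpow_le_rpow_of_nonpos hε (hε0.trans (min_le_right _ _))
      (by norm_num : (-(1/4 : ℝ)) ≤ 0)
    rw [← Real.rpow_mul hc.le] at h
    norm_num at h ⊢
    exact h
  have hgame (k : ℕ) : ∀ t p, t ≤ T → ((k : ℝ) - 1) * ε ^ 2 < t →
      |gameVal μ ε ψ F k t p| ≤ ⨆ q, |ψ q| := by
    induction k with
    | zero =>
      intro t p _ _
      exact le_ciSup (f := fun q => |ψ q|) ⟨M, by rintro _ ⟨q, rfl⟩; exact hM q⟩ p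
    | succ k ih =>
      intro t p htT hkt
      push_cast at hkt
      have ht0 : 0 ≤ t := le_trans (by rw [add_sub_cancel_right]; positivity) hkt.le
      refine abs_gameVal_succ_le hN hlam1.le hμ hε hB ψ F p k (fun η => hF0 t p η ht0 htT)
        (fun η hη X hX => ?_) fun q => ih _ q (by linarith [sq_nonneg ε]) (by linarith)
      simpa [hF0 t p η ht0 htT hη] using
        hF3 t p η ht0 htT hη X 0 hX Matrix.isSymm_zero
  refine hgame _ t p hT ?_
  have hε2 : 0 < ε ^ 2 := by positivity
  rw [← lt_div_iff₀ hε2]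
  linarith [Nat.ceil_lt_add_one (div_nonneg ht hε2.le), show (kIdx ε t : ℝ) = ⌈t / ε ^ 2⌉₊ from rfl]
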